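/- arXiv:1309.7778 — 4 statements merged into one kernel-verified Lean document; each statement's English description precedes it below -/
import Mathlib

section
/- Let m ≥ 1 and j ≥ 2 be integers, let ν > m be real, let σ > 0 and 1 < q < ∞. Then there exists a constant c > 0, depending only on m, j, ν, σ, q, such that for every finite nonnegative Borel measure μ on ℝ^m one has (1/c) ∫₀^∞ F_{ν,m}[μ](τ) h_{σ,j}(τ) dτ ≤ I^{m,j}_{ν,σ}(μ) ≤ c ∫₀^∞ F_{ν,m}[μ](τ) h_{σ,j}(τ) dτ, where both sides are allowed to take the value +∞. -/
open MeasureTheory Set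
open scoped ENNReal

/-- The inner kernel `∫ (τ² + |y − z|²)^{−ν/2} dμ(z)`. -/
noncomputable def innerKernel (m : ℕ) (ν : ℝ) (μ : Measure (EuclideanSpace ℝ (Fin m)))
    (τ : ℝ) (y : EuclideanSpace ℝ (Fin m)) : ℝ≥0∞ :=
  ∫⁻ z, ENNReal.ofReal ((τ ^ 2 + ‖y - z‖ ^ 2) ^ (-ν / 2)) ∂μ

/-- `F_{ν,m}[μ](τ)`. -/
noncomputable def Fnm (m : ℕ) (ν q : ℝ) (μ : Measure (EuclideanSpace ℝ (Fin m))) (τ : ℝ) : ℝ≥0∞ :=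
  ∫⁻ y, innerKernel m ν μ τ y ^ q

/-- The weight `h_{σ,j}`. -/
noncomputable def hWeight (σ q : ℝ) (j : ℕ) (τ : ℝ) : ℝ :=
  if 2 ≤ j then τ ^ ((σ + 1) * q + j - 2) / (1 + τ) ^ ((σ + 1) * q)
  else Real.exp (-τ) * τ ^ ((σ + 1) * q - 1)

/-- The half-space integral `I^{m,j}_{ν,σ}(μ)`, with `y = (y₁, ỹ, y'') ∈ ℝ × ℝ^{j−1} × ℝ^m`. -/
noncomputable def Imj (m j : ℕ) (ν σ q : ℝ) (μ : Measure (EuclideanSpace ℝ (Fin m))) : ℝ≥0∞ :=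
  ∫⁻ p : ℝ × EuclideanSpace ℝ (Fin (j - 1)) × EuclideanSpace ℝ (Fin m) in {p | 0 < p.1},
    (∫⁻ z, ENNReal.ofReal
        (p.1 * (p.1 ^ 2 + ‖p.2.1‖ ^ 2 + ‖p.2.2 - z‖ ^ 2) ^ (-ν / 2)) ∂μ) ^ q *
      ENNReal.ofReal (Real.exp (-p.1) * p.1 ^ (σ * q - 1))

theorem lintegral_Ioi_comp_mul {c : ℝ} (hc : 0 < c) (f : ℝ → ℝ≥0∞) :
    ∫⁻ x in Ioi (0 : ℝ), f x = ∫⁻ x in Ioi (0 : ℝ), ENNReal.ofReal c * f (c * x) := by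
  have himg : (fun x : ℝ => c * x) '' Ioi 0 = Ioi 0 := by
    rw [image_mul_left_Ioi hc, mul_zero]
  have h := lintegral_image_eq_lintegral_abs_deriv_mul (f := fun x : ℝ => c * x)
    (f' := fun _ => c) (measurableSet_Ioi (a := (0 : ℝ)))
    (fun x _ => by simpa using ((hasDerivAt_id x).const_mul c).hasDerivWithinAt)
    (fun x _ y _ hxy => mul_left_cancel₀ hc.ne' hxy) f
  rwa [himg, abs_of_pos hc] at h

theorem lintegral_fun_norm {E : Type*} [NormedAddCommGroup E] [NormedSpace ℝ E]
    [FiniteDimensional ℝ E] [MeasurableSpace E] [BorelSpace E] [Nontrivial E]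
    (μ : Measure E) [μ.IsAddHaarMeasure] {f : ℝ → ℝ≥0∞} (hf : Measurable f) :
    ∫⁻ x, f ‖x‖ ∂μ = μ.toSphere univ *
      ∫⁻ r in Ioi (0 : ℝ), ENNReal.ofReal (r ^ (Module.finrank ℝ E - 1)) * f r := by
  calc
    ∫⁻ x, f ‖x‖ ∂μ = ∫⁻ x : ({(0 : E)}ᶜ : Set E), f ‖x.1‖ ∂(μ.comap (↑)) := by
      rw [lintegral_subtype_comap (measurableSet_singleton _).compl fun x => f ‖x‖,
        restrict_compl_singleton]
    _ = ∫⁻ x, f x.2.1 ∂(μ.toSphere.prod (.volumeIoiPow (Module.finrank ℝ E - 1))) := by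
      rw [← μ.measurePreserving_homeomorphUnitSphereProd.lintegral_comp
        (f := fun x => f x.2.1) (by fun_prop)]
      simp
    _ = μ.toSphere univ * ∫⁻ x : Ioi (0 : ℝ), f x ∂.volumeIoiPow (Module.finrank ℝ E - 1) := by
      rw [lintegral_prod _ (by fun_prop)]
      simp [mul_comm]
    _ = _ := by
      rw [Measure.volumeIoiPow, lintegral_withDensity_eq_lintegral_mul _ (by fun_prop)
        (by fun_prop), ← lintegral_subtype_comap measurableSet_Ioi]
      rfl

/-- The angular weight left over from the half-plane integral after the substitutions
`y₁ = r t` and `τ = r √(1 + t²)`. -/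
noncomputable def angularKernel (n : ℕ) (a τ t : ℝ) : ℝ :=
  (√(1 + t ^ 2) ^ (n + 2))⁻¹ * (t / √(1 + t ^ 2)) ^ (a - 1) * Real.exp (-(τ * (t / √(1 + t ^ 2))))

theorem lintegral_halfPlane_eq (n : ℕ) (a : ℝ) {Φ : ℝ → ℝ≥0∞} (hΦ : Measurable Φ) :
    ∫⁻ s in Ioi (0 : ℝ), ∫⁻ r in Ioi (0 : ℝ), ENNReal.ofReal (r ^ n) *
        (Φ √(s ^ 2 + r ^ 2) * ENNReal.ofReal (Real.exp (-s) * s ^ (a - 1))) =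
      ∫⁻ τ in Ioi (0 : ℝ), Φ τ * ENNReal.ofReal (τ ^ (a + n)) *
        ∫⁻ t in Ioi (0 : ℝ), ENNReal.ofReal (angularKernel n a τ t) := by
  calc
    _ = ∫⁻ r in Ioi (0 : ℝ), ∫⁻ s in Ioi (0 : ℝ), ENNReal.ofReal (r ^ n) *
        (Φ √(s ^ 2 + r ^ 2) * ENNReal.ofReal (Real.exp (-s) * s ^ (a - 1))) :=
      lintegral_lintegral_swap (by fun_prop)
    _ = ∫⁻ r in Ioi (0 : ℝ), ∫⁻ t in Ioi (0 : ℝ), ENNReal.ofReal r * (ENNReal.ofReal (r ^ n) *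
        (Φ √((r * t) ^ 2 + r ^ 2) *
          ENNReal.ofReal (Real.exp (-(r * t)) * (r * t) ^ (a - 1)))) :=
      setLIntegral_congr_fun measurableSet_Ioi fun r hr => lintegral_Ioi_comp_mul hr _
    _ = ∫⁻ t in Ioi (0 : ℝ), ∫⁻ r in Ioi (0 : ℝ), ENNReal.ofReal r * (ENNReal.ofReal (r ^ n) *
        (Φ √((r * t) ^ 2 + r ^ 2) *
          ENNReal.ofReal (Real.exp (-(r * t)) * (r * t) ^ (a - 1)))) :=
      lintegral_lintegral_swap (by fun_prop)
    _ = ∫⁻ t in Ioi (0 : ℝ), ∫⁻ τ in Ioi (0 : ℝ), Φ τ * ENNReal.ofReal (τ ^ (a + n)) *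
          ENNReal.ofReal (angularKernel n a τ t) := by
      refine setLIntegral_congr_fun measurableSet_Ioi fun t ht => ?_
      have ht : 0 < t := ht
      have hs : 0 < √(1 + t ^ 2) := by positivity
      have hs2 : √(1 + t ^ 2) ^ 2 = 1 + t ^ 2 := Real.sq_sqrt (by positivity)
      rw [lintegral_Ioi_comp_mul (inv_pos.2 hs)]
      refine setLIntegral_congr_fun measurableSet_Ioi fun τ hτ => ?_
      have hτ : 0 < τ := hτ
      dsimp only [angularKernel]
      set s := √(1 + t ^ 2)
      have h1 : √((s⁻¹ * τ * t) ^ 2 + (s⁻¹ * τ) ^ 2) = τ := by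
        rw [show (s⁻¹ * τ * t) ^ 2 + (s⁻¹ * τ) ^ 2 = τ ^ 2 by
          field_simp; rw [hs2]; ring]
        exact Real.sqrt_sq hτ.le
      have h2 : s⁻¹ * τ * t = τ * (t / s) := by field_simp
      rw [h1, h2, Real.mul_rpow hτ.le (by positivity), mul_left_comm _ (Φ τ),
        mul_left_comm _ (Φ τ), mul_left_comm _ (Φ τ), mul_assoc (Φ τ)]
      congr 1
      rw [← ENNReal.ofReal_mul (by positivity), ← ENNReal.ofReal_mul (by positivity),
        ← ENNReal.ofReal_mul (by positivity), ← ENNReal.ofReal_mul (by positivity)]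
      congr 1
      rw [show a + n = (a - 1) + 1 + n by ring, Real.rpow_add hτ, Real.rpow_add hτ,
        Real.rpow_one, Real.rpow_natCast, mul_pow, inv_pow]
      field_simp
      ring
    _ = ∫⁻ τ in Ioi (0 : ℝ), ∫⁻ t in Ioi (0 : ℝ), Φ τ * ENNReal.ofReal (τ ^ (a + n)) *
          ENNReal.ofReal (angularKernel n a τ t) :=
      lintegral_lintegral_swap (by unfold angularKernel; fun_prop)
    _ = _ := by
      refine lintegral_congr fun τ => ?_
      exact lintegral_const_mul _ (by unfold angularKernel; fun_prop)

theorem rpow_mul_exp_neg_le {a x : ℝ} (ha : 0 < a) (hx : 0 ≤ x) :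
    x ^ a * Real.exp (-x) ≤ a ^ a := by
  have h1 : x ≤ a * Real.exp (x / a) := by
    have := Real.add_one_le_exp (x / a)
    calc x = a * (x / a) := by field_simp
      _ ≤ _ := by gcongr; linarith
  calc x ^ a * Real.exp (-x) ≤ (a * Real.exp (x / a)) ^ a * Real.exp (-x) := by gcongr
    _ = a ^ a := by
      rw [Real.mul_rpow ha.le (Real.exp_pos _).le, ← Real.exp_mul, div_mul_cancel₀ _ ha.ne',
        mul_assoc, ← Real.exp_add]
      simp

theorem angularKernel_le (n : ℕ) {a τ t : ℝ} (ha : 1 < a) (hτ : 0 < τ) (ht : 0 < t) :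
    angularKernel n a τ t ≤ Real.exp 1 * (t ^ (a - 1) * Real.exp (-((1 + τ) / 2 * t))) +
      Real.exp 1 * (2 * a ^ a * (1 + τ) ^ (-a)) * (1 + t ^ 2)⁻¹ := by
  have hs2 : √(1 + t ^ 2) ^ 2 = 1 + t ^ 2 := Real.sq_sqrt (by positivity)
  have hs1 : 1 ≤ √(1 + t ^ 2) := Real.one_le_sqrt.2 (by nlinarith)
  unfold angularKernel
  set s := √(1 + t ^ 2)
  have hs : 0 < s := by positivity
  have hts : t < s := by nlinarith
  have hu0 : 0 < t / s := by positivity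
  have hu1 : t / s ≤ 1 := (div_le_one hs).2 hts.le
  have hut : t / s ≤ t := div_le_self ht.le hs1
  have hpow : (s ^ (n + 2))⁻¹ ≤ (1 + t ^ 2)⁻¹ := by
    rw [← hs2]
    exact inv_anti₀ (by positivity) (pow_le_pow_right₀ hs1 (by omega))
  have hexp : Real.exp (-(τ * (t / s))) ≤ Real.exp 1 * Real.exp (-((1 + τ) * (t / s))) := by
    rw [← Real.exp_add]
    gcongr
    linarith
  rcases le_total t 1 with h | h
  · have hu2 : t / 2 ≤ t / s := by
      gcongr
      nlinarith
    have : (s ^ (n + 2))⁻¹ * (t / s) ^ (a - 1) * Real.exp (-(τ * (t / s))) ≤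
        1 * t ^ (a - 1) * (Real.exp 1 * Real.exp (-((1 + τ) / 2 * t))) := by
      have h1 : (s ^ (n + 2))⁻¹ ≤ 1 := inv_le_one_of_one_le₀ (one_le_pow₀ hs1)
      have h2 : Real.exp (-((1 + τ) * (t / s))) ≤ Real.exp (-((1 + τ) / 2 * t)) := by
        refine Real.exp_le_exp.2 (neg_le_neg ?_)
        nlinarith
      have h3 : (t / s) ^ (a - 1) ≤ t ^ (a - 1) :=
        Real.rpow_le_rpow hu0.le hut (by linarith)
      exact mul_le_mul (mul_le_mul h1 h3 (by positivity) zero_le_one)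
        (hexp.trans (mul_le_mul_of_nonneg_left h2 (Real.exp_pos _).le)) (by positivity) (by positivity)
    have h4 : 0 ≤ Real.exp 1 * (2 * a ^ a * (1 + τ) ^ (-a)) * (1 + t ^ 2)⁻¹ := by positivity
    linarith
  · have hu2 : 1 / 2 ≤ t / s := by
      rw [div_le_div_iff₀ two_pos hs]
      nlinarith
    have h1 : (t / s) ^ (a - 1) ≤ 2 * (t / s) ^ a := by
      rw [Real.rpow_sub_one hu0.ne', div_le_iff₀ hu0]
      nlinarith [Real.rpow_pos_of_pos hu0 a]
    have h2 : (t / s) ^ a * Real.exp (-((1 + τ) * (t / s))) ≤ a ^ a * (1 + τ) ^ (-a) := by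
      have := rpow_mul_exp_neg_le (a := a) (by linarith) (x := (1 + τ) * (t / s)) (by positivity)
      rw [Real.mul_rpow (by positivity) hu0.le] at this
      rw [Real.rpow_neg (by positivity), ← div_eq_mul_inv, le_div_iff₀ (by positivity)]
      linarith
    calc (s ^ (n + 2))⁻¹ * (t / s) ^ (a - 1) * Real.exp (-(τ * (t / s)))
        ≤ (1 + t ^ 2)⁻¹ * (2 * (t / s) ^ a) *
          (Real.exp 1 * Real.exp (-((1 + τ) * (t / s)))) := by gcongr
      _ = Real.exp 1 * (2 * ((t / s) ^ a * Real.exp (-((1 + τ) * (t / s))))) * (1 + t ^ 2)⁻¹ := by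
        ring
      _ ≤ Real.exp 1 * (2 * (a ^ a * (1 + τ) ^ (-a))) * (1 + t ^ 2)⁻¹ := by gcongr
      _ ≤ _ := by
        rw [← mul_assoc 2]
        have : 0 ≤ Real.exp 1 * (t ^ (a - 1) * Real.exp (-((1 + τ) / 2 * t))) := by positivity
        linarith

theorem exists_lintegral_angularKernel_le (n : ℕ) {a : ℝ} (ha : 1 < a) :
    ∃ C : ℝ, 0 < C ∧ ∀ τ : ℝ, 0 < τ →
      ∫⁻ t in Ioi (0 : ℝ), ENNReal.ofReal (angularKernel n a τ t) ≤
        ENNReal.ofReal (C * (1 + τ) ^ (-a)) := by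
  have hG := Real.Gamma_pos_of_pos (zero_lt_one.trans ha)
  have hI0 : 0 ≤ ∫ t in Ioi (0 : ℝ), (1 + t ^ 2)⁻¹ := integral_nonneg fun t => by positivity
  refine ⟨Real.exp 1 * (2 ^ a * Real.Gamma a) +
    Real.exp 1 * (2 * a ^ a) * ∫ t in Ioi (0 : ℝ), (1 + t ^ 2)⁻¹, by positivity, fun τ hτ => ?_⟩
  have hT : 0 < (1 + τ) / 2 := by positivity
  have hint1 : IntegrableOn (fun t : ℝ => t ^ (a - 1) * Real.exp (-((1 + τ) / 2 * t))) (Ioi 0) := by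
    refine Integrable.of_integral_ne_zero ?_
    rw [Real.integral_rpow_mul_exp_neg_mul_Ioi (by linarith) hT]
    positivity
  have hint2 : IntegrableOn (fun t : ℝ => (1 + t ^ 2)⁻¹) (Ioi 0) :=
    integrable_inv_one_add_sq.integrableOn
  calc
    _ ≤ ∫⁻ t in Ioi (0 : ℝ), ENNReal.ofReal
        (Real.exp 1 * (t ^ (a - 1) * Real.exp (-((1 + τ) / 2 * t))) +
          Real.exp 1 * (2 * a ^ a * (1 + τ) ^ (-a)) * (1 + t ^ 2)⁻¹) :=
      setLIntegral_mono' measurableSet_Ioi fun t ht =>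
        ENNReal.ofReal_le_ofReal (angularKernel_le n ha hτ ht)
    _ = ENNReal.ofReal _ := by
      refine (ofReal_integral_eq_lintegral_ofReal
        ((hint1.const_mul _).add (hint2.const_mul _)) ?_).symm
      filter_upwards [ae_restrict_mem measurableSet_Ioi] with t ht
      have ht : 0 < t := ht
      show (0 : ℝ) ≤ Real.exp 1 * (t ^ (a - 1) * Real.exp (-((1 + τ) / 2 * t))) +
        Real.exp 1 * (2 * a ^ a * (1 + τ) ^ (-a)) * (1 + t ^ 2)⁻¹
      positivity
    _ = _ := by
      congr 1
      simp only [Pi.add_apply]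
      rw [integral_add (hint1.const_mul _) (hint2.const_mul _), integral_const_mul,
        integral_const_mul, Real.integral_rpow_mul_exp_neg_mul_Ioi (by linarith) hT, one_div_div,
        Real.div_rpow two_pos.le (by positivity), Real.rpow_neg (by positivity)]
      ring

theorem le_angularKernel (n : ℕ) {a τ t : ℝ} (ha : 1 < a) (hτ : 0 < τ) (ht : 0 < t)
    (htτ : t ≤ (1 + τ)⁻¹) :
    (2 ^ (n + 2) : ℝ)⁻¹ * (2 ^ (a - 1))⁻¹ * Real.exp (-1) * t ^ (a - 1) ≤
      angularKernel n a τ t := by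
  have ht1 : t ≤ 1 := htτ.trans (inv_le_one_of_one_le₀ (by linarith))
  have hτt : τ * t ≤ 1 := by
    rw [← one_div, le_div_iff₀ (by positivity)] at htτ
    linarith
  have hs2 : √(1 + t ^ 2) ^ 2 = 1 + t ^ 2 := Real.sq_sqrt (by positivity)
  have hs1 : 1 ≤ √(1 + t ^ 2) := Real.one_le_sqrt.2 (by nlinarith)
  unfold angularKernel
  set s := √(1 + t ^ 2)
  have hs : 0 < s := by positivity
  have hsle : s ≤ 2 := by nlinarith
  have hut : t / s ≤ t := div_le_self ht.le hs1
  have h1 : (2 ^ (a - 1) : ℝ)⁻¹ * t ^ (a - 1) ≤ (t / s) ^ (a - 1) := by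
    rw [mul_comm, ← div_eq_mul_inv, ← Real.div_rpow ht.le two_pos.le]
    exact Real.rpow_le_rpow (by positivity) (by gcongr) (by linarith)
  calc _ = (2 ^ (n + 2) : ℝ)⁻¹ * ((2 ^ (a - 1))⁻¹ * t ^ (a - 1)) * Real.exp (-1) := by ring
    _ ≤ _ := by
      gcongr
      nlinarith

theorem exists_le_lintegral_angularKernel (n : ℕ) {a : ℝ} (ha : 1 < a) :
    ∃ C : ℝ, 0 < C ∧ ∀ τ : ℝ, 0 < τ →
      ENNReal.ofReal (C * (1 + τ) ^ (-a)) ≤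
        ∫⁻ t in Ioi (0 : ℝ), ENNReal.ofReal (angularKernel n a τ t) := by
  have ha0 : 0 < a := zero_lt_one.trans ha
  set b : ℝ := (2 ^ (n + 2) : ℝ)⁻¹ * (2 ^ (a - 1))⁻¹ * Real.exp (-1) with hb
  refine ⟨b / a, by positivity, fun τ hτ => ?_⟩
  have hT : 0 ≤ (1 + τ)⁻¹ := by positivity
  have hint : IntervalIntegrable (fun t : ℝ => b * t ^ (a - 1)) volume 0 (1 + τ)⁻¹ :=
    (intervalIntegral.intervalIntegrable_rpow' (by linarith)).const_mul _
  calc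
    _ = ENNReal.ofReal (∫ t in Ioc 0 (1 + τ)⁻¹, b * t ^ (a - 1)) := by
      rw [← intervalIntegral.integral_of_le hT, intervalIntegral.integral_const_mul,
        integral_rpow (Or.inl (by linarith)), sub_add_cancel, Real.zero_rpow ha0.ne', sub_zero,
        Real.inv_rpow (by positivity), Real.rpow_neg (by positivity)]
      congr 1
      ring
    _ = ∫⁻ t in Ioc 0 (1 + τ)⁻¹, ENNReal.ofReal (b * t ^ (a - 1)) := by
      refine ofReal_integral_eq_lintegral_ofReal hint.1 ?_
      filter_upwards [ae_restrict_mem measurableSet_Ioc] with t ht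
      have ht := ht.1
      show (0 : ℝ) ≤ _
      positivity
    _ ≤ ∫⁻ t in Ioc 0 (1 + τ)⁻¹, ENNReal.ofReal (angularKernel n a τ t) :=
      setLIntegral_mono' measurableSet_Ioc fun t ht =>
        ENNReal.ofReal_le_ofReal (le_angularKernel n ha hτ ht.1 ht.2)
    _ ≤ _ := lintegral_mono_set Ioc_subset_Ioi_self

theorem measurable_innerKernel (m : ℕ) (ν : ℝ) (μ : Measure (EuclideanSpace ℝ (Fin m)))
    [SFinite μ] :
    Measurable fun p : ℝ × EuclideanSpace ℝ (Fin m) => innerKernel m ν μ p.1 p.2 := by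
  unfold innerKernel
  exact Measurable.lintegral_prod_right' (f := fun p : (ℝ × EuclideanSpace ℝ (Fin m)) ×
    EuclideanSpace ℝ (Fin m) =>
      ENNReal.ofReal ((p.1.1 ^ 2 + ‖p.1.2 - p.2‖ ^ 2) ^ (-ν / 2))) (by fun_prop)

theorem measurable_Fnm (m : ℕ) (ν q : ℝ) (μ : Measure (EuclideanSpace ℝ (Fin m)))
    [SFinite μ] : Measurable (Fnm m ν q μ) := by
  unfold Fnm
  exact Measurable.lintegral_prod_right' (f := fun p : ℝ × EuclideanSpace ℝ (Fin m) =>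
    innerKernel m ν μ p.1 p.2 ^ q) ((measurable_innerKernel m ν μ).pow_const q)

theorem Imj_eq_lintegral_Fnm (m j : ℕ) {ν σ q : ℝ} (hq : 0 ≤ q)
    (μ : Measure (EuclideanSpace ℝ (Fin m))) [SFinite μ] :
    Imj m j ν σ q μ = ∫⁻ s in Ioi (0 : ℝ), ∫⁻ x : EuclideanSpace ℝ (Fin (j - 1)),
      Fnm m ν q μ √(s ^ 2 + ‖x‖ ^ 2) *
        ENNReal.ofReal (Real.exp (-s) * s ^ ((σ + 1) * q - 1)) := by
  have hK := measurable_innerKernel m ν μ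
  have hset : {p : ℝ × EuclideanSpace ℝ (Fin (j - 1)) × EuclideanSpace ℝ (Fin m) | 0 < p.1} =
      Ioi 0 ×ˢ univ := by ext; simp
  have hmeas : Measurable fun p : ℝ × EuclideanSpace ℝ (Fin (j - 1)) ×
      EuclideanSpace ℝ (Fin m) => innerKernel m ν μ √(p.1 ^ 2 + ‖p.2.1‖ ^ 2) p.2.2 ^ q *
        ENNReal.ofReal (Real.exp (-p.1) * p.1 ^ ((σ + 1) * q - 1)) :=
    ((hK.comp (f := fun p : ℝ × EuclideanSpace ℝ (Fin (j - 1)) × EuclideanSpace ℝ (Fin m) =>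
      (√(p.1 ^ 2 + ‖p.2.1‖ ^ 2), p.2.2)) (by fun_prop)).pow_const q).mul (by fun_prop)
  calc
    _ = ∫⁻ p : ℝ × EuclideanSpace ℝ (Fin (j - 1)) × EuclideanSpace ℝ (Fin m) in {p | 0 < p.1},
        innerKernel m ν μ √(p.1 ^ 2 + ‖p.2.1‖ ^ 2) p.2.2 ^ q *
          ENNReal.ofReal (Real.exp (-p.1) * p.1 ^ ((σ + 1) * q - 1)) := by
      refine setLIntegral_congr_fun (measurableSet_lt measurable_const measurable_fst)
        fun p hp => ?_
      have hp : 0 < p.1 := hp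
      have h1 : (∫⁻ z, ENNReal.ofReal
          (p.1 * (p.1 ^ 2 + ‖p.2.1‖ ^ 2 + ‖p.2.2 - z‖ ^ 2) ^ (-ν / 2)) ∂μ) =
          ENNReal.ofReal p.1 * innerKernel m ν μ √(p.1 ^ 2 + ‖p.2.1‖ ^ 2) p.2.2 := by
        rw [innerKernel, ← lintegral_const_mul _ (by fun_prop)]
        refine lintegral_congr fun z => ?_
        rw [Real.sq_sqrt (by positivity), ENNReal.ofReal_mul hp.le]
      rw [h1, ENNReal.mul_rpow_of_nonneg _ _ hq, ENNReal.ofReal_rpow_of_pos hp,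
        mul_comm (ENNReal.ofReal _), mul_assoc, ← ENNReal.ofReal_mul (by positivity),
        show (σ + 1) * q - 1 = q + (σ * q - 1) by ring, Real.rpow_add hp]
      congr 2
      ring
    _ = _ := by
      rw [hset, Measure.volume_eq_prod, ← Measure.prod_restrict, Measure.restrict_univ,
        lintegral_prod _ hmeas.aemeasurable]
      refine lintegral_congr fun s => ?_
      rw [Measure.volume_eq_prod, lintegral_prod _ (by exact (hmeas.comp measurable_prodMk_left).aemeasurable)]
      refine lintegral_congr fun x => ?_
      dsimp only [Fnm]
      rw [lintegral_mul_const]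
      exact (hK.comp (measurable_prodMk_left (x := √(s ^ 2 + ‖x‖ ^ 2)))).pow_const q

theorem Imj_eq_lintegral_angularKernel (m j : ℕ) (hj : 2 ≤ j) {ν σ q : ℝ} (hq : 0 ≤ q)
    (μ : Measure (EuclideanSpace ℝ (Fin m))) [SFinite μ] :
    Imj m j ν σ q μ =
      (volume : Measure (EuclideanSpace ℝ (Fin (j - 1)))).toSphere univ *
        ∫⁻ τ in Ioi (0 : ℝ), Fnm m ν q μ τ *
          ENNReal.ofReal (τ ^ ((σ + 1) * q + (j - 2 : ℕ))) *
          ∫⁻ t in Ioi (0 : ℝ), ENNReal.ofReal (angularKernel (j - 2) ((σ + 1) * q) τ t) := by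
  have hF := measurable_Fnm m ν q μ
  have : Nonempty (Fin (j - 1)) := ⟨⟨0, by omega⟩⟩
  rw [Imj_eq_lintegral_Fnm m j hq μ, ← lintegral_halfPlane_eq _ _ hF,
    ← lintegral_const_mul]
  · refine lintegral_congr fun s => ?_
    rw [lintegral_fun_norm volume (f := fun r => Fnm m ν q μ √(s ^ 2 + r ^ 2) *
      ENNReal.ofReal (Real.exp (-s) * s ^ ((σ + 1) * q - 1))) (by fun_prop)]
    simp only [finrank_euclideanSpace, Fintype.card_fin, Nat.sub_sub]
  · exact Measurable.lintegral_prod_right' (f := fun p : ℝ × ℝ => ENNReal.ofReal (p.2 ^ (j - 2)) *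
      (Fnm m ν q μ √(p.1 ^ 2 + p.2 ^ 2) *
        ENNReal.ofReal (Real.exp (-p.1) * p.1 ^ ((σ + 1) * q - 1)))) (by fun_prop)

/-- Lemma 3.3: two-sided comparison of `I^{m,j}_{ν,σ}(μ)` with
`∫₀^∞ F_{ν,m}[μ](τ) h_{σ,j}(τ) dτ` for `j ≥ 2`. -/
theorem lemma_3_3 (m j : ℕ) (hm : 1 ≤ m) (hj : 2 ≤ j) (ν σ q : ℝ)
    (hν : (m : ℝ) < ν) (hσ : 0 < σ) (hq : 1 < q) :
    ∃ c : ℝ, 0 < c ∧ ∀ μ : Measure (EuclideanSpace ℝ (Fin m)), IsFiniteMeasure μ →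
      ENNReal.ofReal (1 / c) *
          (∫⁻ τ in Ioi (0 : ℝ), Fnm m ν q μ τ * ENNReal.ofReal (hWeight σ q j τ)) ≤
        Imj m j ν σ q μ ∧
      Imj m j ν σ q μ ≤ ENNReal.ofReal c *
          (∫⁻ τ in Ioi (0 : ℝ), Fnm m ν q μ τ * ENNReal.ofReal (hWeight σ q j τ)) := by
  have hj2 : ((j - 2 : ℕ) : ℝ) = j - 2 := by push_cast [hj]; ring
  have ha : 1 < (σ + 1) * q := by nlinarith
  obtain ⟨A, hA, hupper⟩ := exists_lintegral_angularKernel_le (j - 2) ha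
  obtain ⟨B, hB, hlower⟩ := exists_le_lintegral_angularKernel (j - 2) ha
  have : Nonempty (Fin (j - 1)) := ⟨⟨0, by omega⟩⟩
  set S := (volume : Measure (EuclideanSpace ℝ (Fin (j - 1)))).toSphere univ with hS
  have hStop : S ≠ ∞ := measure_ne_top _ _
  have hS0 : S ≠ 0 := by
    rw [hS, Measure.toSphere_apply_univ]
    exact mul_ne_zero (by rw [finrank_euclideanSpace_fin]; exact Nat.cast_ne_zero.2 (by omega)) (Metric.measure_ball_pos _ _ one_pos).ne'
  have hSr : 0 < S.toReal := ENNReal.toReal_pos hS0 hStop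
  refine ⟨max (S.toReal * A) (1 / (S.toReal * B)), by positivity, fun μ _ => ?_⟩
  have hweight : ∀ C τ : ℝ, 0 < C → 0 < τ →
      ENNReal.ofReal (τ ^ ((σ + 1) * q + (j - 2 : ℕ))) *
          ENNReal.ofReal (C * (1 + τ) ^ (-((σ + 1) * q))) =
        ENNReal.ofReal C * ENNReal.ofReal (hWeight σ q j τ) := by
    intro C τ hC hτ
    rw [← ENNReal.ofReal_mul (by positivity), ← ENNReal.ofReal_mul hC.le, hWeight, if_pos hj, hj2,
      Real.rpow_neg (by positivity), add_sub_assoc]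
    congr 1
    ring
  have hconst : ∀ C : ℝ, 0 < C →
      ENNReal.ofReal (S.toReal * C) *
          (∫⁻ τ in Ioi (0 : ℝ), Fnm m ν q μ τ * ENNReal.ofReal (hWeight σ q j τ)) =
        S * ∫⁻ τ in Ioi (0 : ℝ), Fnm m ν q μ τ *
          ENNReal.ofReal (τ ^ ((σ + 1) * q + (j - 2 : ℕ))) *
          ENNReal.ofReal (C * (1 + τ) ^ (-((σ + 1) * q))) := by
    intro C hC
    rw [ENNReal.ofReal_mul hSr.le, ENNReal.ofReal_toReal hStop, mul_assoc,
      ← lintegral_const_mul' _ _ ENNReal.ofReal_ne_top]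
    congr 1
    refine setLIntegral_congr_fun measurableSet_Ioi fun τ hτ => ?_
    rw [mul_assoc, hweight C τ hC hτ, mul_left_comm]
  rw [Imj_eq_lintegral_angularKernel m j hj (by linarith) μ, ← hS]
  constructor
  · calc
      _ ≤ ENNReal.ofReal (S.toReal * B) *
          (∫⁻ τ in Ioi (0 : ℝ), Fnm m ν q μ τ * ENNReal.ofReal (hWeight σ q j τ)) := by
        gcongr
        rw [one_div]
        exact inv_le_of_inv_le₀ (by positivity) (by rw [← one_div]; exact le_max_right _ _)
      _ = _ := hconst B hB
      _ ≤ _ := by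
        gcongr S * ?_
        exact setLIntegral_mono' measurableSet_Ioi fun τ hτ => by
          gcongr
          exact hlower τ hτ
  · calc
      _ ≤ _ := by
        gcongr S * ?_
        exact setLIntegral_mono' measurableSet_Ioi fun τ hτ => by
          gcongr
          exact hupper τ hτ
      _ = _ := (hconst A hA).symm
      _ ≤ _ := by
        gcongr
        exact le_max_left _ _
end

section
/- Let N and k be integers with 2 ≤ k ≤ N − 1, let κ > 0 and q > 1 be real numbers, and let R > 0. Then the iterated integral ∫₀^R ∫₀^R (r² + t²)^{q(2−N−2κ)/2} r^{(q+1)κ+k−1} t^{N−k−1} dt dr is finite if and only if q < (κ + N)/(κ + N − 2). -/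
open MeasureTheory Set
open scoped ENNReal

theorem lintegral_Ioo_rpow_ne_top_iff {s R : ℝ} (hR : 0 < R) :
    (∫⁻ x in Ioo (0 : ℝ) R, ENNReal.ofReal (x ^ s)) ≠ ∞ ↔ -1 < s := by
  rw [← intervalIntegral.integrableOn_Ioo_rpow_iff hR, IntegrableOn,
    ← lintegral_ofReal_ne_top_iff_integrable]
  · exact (by fun_prop : Measurable fun x : ℝ => x ^ s).aestronglyMeasurable
  · exact (ae_restrict_mem measurableSet_Ioo).mono fun x hx => Real.rpow_nonneg hx.1.le s

theorem rpow_mul_rpow_le_sq_add_sq {r t θ : ℝ} (hr : 0 < r) (ht : 0 < t)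
    (hθ : 0 ≤ θ) (hθ' : θ ≤ 1) :
    r ^ (2 * θ) * t ^ (2 * (1 - θ)) ≤ r ^ 2 + t ^ 2 := by
  rw [Real.rpow_mul hr.le, Real.rpow_mul ht.le, Real.rpow_two, Real.rpow_two]
  have h := Real.geom_mean_le_arith_mean2_weighted hθ (sub_nonneg.2 hθ') (sq_nonneg r)
    (sq_nonneg t) (by ring)
  nlinarith [sq_nonneg r, sq_nonneg t, mul_nonneg hθ (sq_nonneg t),
    mul_nonneg (sub_nonneg.2 hθ') (sq_nonneg r)]

theorem lintegral_sq_add_sq_rpow_ne_top {p a b R : ℝ} (hR : 0 < R) (hp : 0 ≤ p)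
    (ha : -1 < a) (hb : -1 < b) (hs : 2 * p < a + b + 2) :
    (∫⁻ r in Ioo (0 : ℝ) R, ∫⁻ t in Ioo (0 : ℝ) R,
      ENNReal.ofReal ((r ^ 2 + t ^ 2) ^ (-p) * r ^ a * t ^ b)) ≠ ∞ := by
  have hab : 0 < a + b + 2 := by linarith
  obtain ⟨θ, hθ⟩ : ∃ θ, θ = (a + 1) / (a + b + 2) := ⟨_, rfl⟩
  have hθa : θ * (a + b + 2) = a + 1 := by rw [hθ]; field_simp
  have h0 : 0 < θ := hθ ▸ div_pos (by linarith) hab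
  have h1 : θ < 1 := by rw [hθ, div_lt_one hab]; linarith
  have hra : -1 < a - 2 * p * θ := by nlinarith
  have htb : -1 < b - 2 * p * (1 - θ) := by nlinarith
  have hr := (lintegral_Ioo_rpow_ne_top_iff hR).2 hra
  have ht := (lintegral_Ioo_rpow_ne_top_iff hR).2 htb
  refine ne_top_of_le_ne_top (ENNReal.mul_ne_top hr ht) ?_
  rw [← lintegral_mul_const' _ _ ht]
  refine setLIntegral_mono' measurableSet_Ioo fun r hr => ?_
  rw [← lintegral_const_mul' _ _ ENNReal.ofReal_ne_top]
  refine setLIntegral_mono' measurableSet_Ioo fun t ht => ?_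
  have hr0 := hr.1
  have ht0 := ht.1
  rw [← ENNReal.ofReal_mul (by positivity)]
  apply ENNReal.ofReal_le_ofReal
  have key : (r ^ 2 + t ^ 2) ^ (-p) ≤ r ^ (-(2 * p * θ)) * t ^ (-(2 * p * (1 - θ))) := by
    refine (Real.rpow_le_rpow_of_nonpos (by positivity)
      (rpow_mul_rpow_le_sq_add_sq hr0 ht0 h0.le h1.le) (neg_nonpos.2 hp)).trans_eq ?_
    rw [Real.mul_rpow (by positivity) (by positivity), ← Real.rpow_mul hr0.le,
      ← Real.rpow_mul ht0.le]
    congr 2 <;> ring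
  calc (r ^ 2 + t ^ 2) ^ (-p) * r ^ a * t ^ b
      ≤ r ^ (-(2 * p * θ)) * t ^ (-(2 * p * (1 - θ))) * r ^ a * t ^ b := by gcongr
    _ = (r ^ a * r ^ (-(2 * p * θ))) * (t ^ b * t ^ (-(2 * p * (1 - θ)))) := by ring
    _ = r ^ (a - 2 * p * θ) * t ^ (b - 2 * p * (1 - θ)) := by
      rw [← Real.rpow_add hr0, ← Real.rpow_add ht0, ← sub_eq_add_neg, ← sub_eq_add_neg]

theorem lt_of_lintegral_sq_add_sq_rpow_ne_top {p a b R : ℝ} (hR : 0 < R) (hp : 0 ≤ p)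
    (hb : 0 ≤ b)
    (h : (∫⁻ r in Ioo (0 : ℝ) R, ∫⁻ t in Ioo (0 : ℝ) R,
      ENNReal.ofReal ((r ^ 2 + t ^ 2) ^ (-p) * r ^ a * t ^ b)) ≠ ∞) :
    2 * p < a + b + 2 := by
  obtain ⟨C, hC⟩ : ∃ C : ℝ, C = 2 ^ (-p) * 2⁻¹ ^ b * 2⁻¹ := ⟨_, rfl⟩
  have hC0 : 0 < C := by rw [hC]; positivity
  have hle : ENNReal.ofReal C * (∫⁻ r in Ioo (0 : ℝ) R, ENNReal.ofReal (r ^ (-(2 * p) + a + b + 1)))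
      ≤ ∫⁻ r in Ioo (0 : ℝ) R, ∫⁻ t in Ioo (0 : ℝ) R,
        ENNReal.ofReal ((r ^ 2 + t ^ 2) ^ (-p) * r ^ a * t ^ b) := by
    rw [← lintegral_const_mul' _ _ ENNReal.ofReal_ne_top]
    refine setLIntegral_mono' measurableSet_Ioo fun r hr => ?_
    have hr0 := hr.1
    have hsub : Ioo (r / 2) r ⊆ Ioo 0 R := Ioo_subset_Ioo (by linarith) hr.2.le
    refine le_trans ?_ (lintegral_mono_set hsub)
    calc ENNReal.ofReal C * ENNReal.ofReal (r ^ (-(2 * p) + a + b + 1))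
        = ENNReal.ofReal ((2 * r ^ 2) ^ (-p) * r ^ a * (2⁻¹ * r) ^ b) *
            volume (Ioo (r / 2) r) := by
          rw [Real.volume_Ioo, ← ENNReal.ofReal_mul hC0.le,
            ← ENNReal.ofReal_mul (by positivity), Real.mul_rpow (by norm_num) (by positivity),
            Real.mul_rpow (by norm_num) hr0.le, ← Real.rpow_natCast_mul hr0.le,
            Real.rpow_add hr0, Real.rpow_add hr0, Real.rpow_add hr0, Real.rpow_one, hC]
          congr 1
          push_cast
          rw [mul_neg]
          ring
      _ = ∫⁻ _ in Ioo (r / 2) r,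
            ENNReal.ofReal ((2 * r ^ 2) ^ (-p) * r ^ a * (2⁻¹ * r) ^ b) := by
          rw [setLIntegral_const]
      _ ≤ _ := by
          refine setLIntegral_mono' measurableSet_Ioo fun t ht => ?_
          have ht0 : 0 < t := by linarith [ht.1]
          apply ENNReal.ofReal_le_ofReal
          have h1 : (2 * r ^ 2) ^ (-p) ≤ (r ^ 2 + t ^ 2) ^ (-p) :=
            Real.rpow_le_rpow_of_nonpos (by positivity) (by nlinarith [ht.2])
              (neg_nonpos.2 hp)
          have h2 : (2⁻¹ * r) ^ b ≤ t ^ b :=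
            Real.rpow_le_rpow (by positivity) (by linarith [ht.1]) hb
          gcongr
  have hfin := ne_top_of_le_ne_top h hle
  have hr : (∫⁻ r in Ioo (0 : ℝ) R, ENNReal.ofReal (r ^ (-(2 * p) + a + b + 1))) ≠ ∞ := by
    intro htop
    rw [htop, ENNReal.mul_top (ENNReal.ofReal_pos.2 hC0).ne'] at hfin
    exact hfin rfl
  linarith [(lintegral_Ioo_rpow_ne_top_iff hR).1 hr]

/-- The iterated integral expressing the admissibility condition for a Dirac mass on the
edge of a `k`-dihedron in `ℝ^N` is finite if and only if `q < (κ + N)/(κ + N − 2)`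
(Proposition 2.2). -/
theorem admissibility_dirac_iff (N k : ℕ) (hk : 2 ≤ k) (hkN : k < N)
    (κ q R : ℝ) (hκ : 0 < κ) (hq : 1 < q) (hR : 0 < R) :
    (∫⁻ r in Ioo (0 : ℝ) R, ∫⁻ t in Ioo (0 : ℝ) R,
        ENNReal.ofReal ((r ^ 2 + t ^ 2) ^ (q * (2 - (N : ℝ) - 2 * κ) / 2) *
          r ^ ((q + 1) * κ + (k : ℝ) - 1) * t ^ ((N : ℝ) - (k : ℝ) - 1))) ≠ ∞ ↔
      q < (κ + N) / (κ + N - 2) := by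
  have hk' : (2 : ℝ) ≤ k := by exact_mod_cast hk
  have hN : (k : ℝ) + 1 ≤ N := by exact_mod_cast hkN
  have hqκ : 0 < (q + 1) * κ := by positivity
  have hp : 0 ≤ q * ((N : ℝ) - 2 + 2 * κ) / 2 :=
    div_nonneg (mul_nonneg (by linarith) (by linarith)) (by norm_num)
  rw [lt_div_iff₀ (by linarith),
    show q * (2 - (N : ℝ) - 2 * κ) / 2 = -(q * ((N : ℝ) - 2 + 2 * κ) / 2) by ring]
  constructor
  · intro h
    linarith [lt_of_lintegral_sq_add_sq_rpow_ne_top hR hp (by linarith) h]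
  · intro h
    exact lintegral_sq_add_sq_rpow_ne_top hR hp (by linarith) (by linarith) (by linarith)
end

section
/- Let j ≥ 2 be an integer and let p > 0 be real. Define Φ(τ) := ∫₀¹ e^{−τ√(1−r²)} r^{j−2} (1−r²)^{p/2−1} dr for τ ≥ 0. Then Φ is continuous and strictly positive on [0, ∞), and there exists a constant c > 0, depending only on j and p, such that Φ(τ) ≤ c τ^{−p} for all τ > 0 and Φ(τ) ≥ (1/c) τ^{−p} for all τ ≥ 2. -/
open MeasureTheory Set
open scoped ENNReal

/-- `Φ(τ) = ∫₀¹ e^{−τ√(1−r²)} r^{j−2} (1−r²)^{p/2−1} dr`. -/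
noncomputable def PhiFun (j : ℕ) (p τ : ℝ) : ℝ :=
  ∫ r in Ioo (0 : ℝ) 1,
    Real.exp (-τ * Real.sqrt (1 - r ^ 2)) * r ^ ((j : ℝ) - 2) * (1 - r ^ 2) ^ (p / 2 - 1)

/-- The integrand of `PhiFun` in the variable `u = 1 - r`. -/
noncomputable def phiKernel (j : ℕ) (p τ u : ℝ) : ℝ :=
  Real.exp (-τ * Real.sqrt (u * (2 - u))) * (1 - u) ^ ((j : ℝ) - 2) *
    (u * (2 - u)) ^ (p / 2 - 1)

lemma PhiFun_eq_integral_phiKernel (j : ℕ) (p τ : ℝ) :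
    PhiFun j p τ = ∫ u in Ioo (0 : ℝ) 1, phiKernel j p τ u := by
  have h := (Measure.measurePreserving_sub_left (volume : Measure ℝ) 1).setIntegral_preimage_emb
    (MeasurableEquiv.subLeft (1 : ℝ)).measurableEmbedding
    (fun r => Real.exp (-τ * Real.sqrt (1 - r ^ 2)) * r ^ ((j : ℝ) - 2) *
      (1 - r ^ 2) ^ (p / 2 - 1)) (Ioo 0 1)
  rw [PhiFun, ← h]
  have hs : (fun x : ℝ => 1 - x) ⁻¹' Ioo 0 1 = Ioo 0 1 := by simp
  rw [hs]
  refine integral_congr_ae (.of_forall fun u => ?_)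
  have hu : 1 - (1 - u) ^ 2 = u * (2 - u) := by ring
  simp only [phiKernel, hu]

lemma measurable_phiKernel (j : ℕ) (p τ : ℝ) : Measurable (phiKernel j p τ) := by
  unfold phiKernel
  fun_prop

lemma phiKernel_pos (j : ℕ) (p τ : ℝ) {u : ℝ} (hu : u ∈ Ioo (0 : ℝ) 1) :
    0 < phiKernel j p τ u := by
  have h1 : 0 < 1 - u := by linarith [hu.2]
  have h2 : 0 < u * (2 - u) := mul_pos hu.1 (by linarith [hu.2])
  unfold phiKernel
  positivity

lemma rpow_le_two_rpow_abs {x : ℝ} (h1 : 1 ≤ x) (h2 : x ≤ 2) (a : ℝ) :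
    x ^ a ≤ 2 ^ |a| :=
  (Real.rpow_le_rpow_of_exponent_le h1 (le_abs_self a)).trans
    (Real.rpow_le_rpow (by linarith) h2 (abs_nonneg a))

lemma two_rpow_neg_abs_le_rpow {x : ℝ} (h1 : 1 ≤ x) (h2 : x ≤ 2) (a : ℝ) :
    2 ^ (-|a|) ≤ x ^ a := by
  have h := rpow_le_two_rpow_abs h1 h2 (-a)
  rw [abs_neg, Real.rpow_neg (by linarith)] at h
  rw [Real.rpow_neg (by norm_num)]
  exact inv_le_of_inv_le₀ (Real.rpow_pos_of_pos (by linarith) a) h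

lemma phiKernel_le {j : ℕ} (hj : 2 ≤ j) (p : ℝ) {τ u : ℝ} (hτ : 0 ≤ τ)
    (hu : u ∈ Ioo (0 : ℝ) 1) :
    phiKernel j p τ u ≤
      2 ^ |p / 2 - 1| * (u ^ (p / 2 - 1) * Real.exp (-τ * u ^ (1 / 2 : ℝ))) := by
  obtain ⟨h0, h1⟩ := hu
  have hj' : (2 : ℝ) ≤ j := by exact_mod_cast hj
  have hexp : Real.exp (-τ * Real.sqrt (u * (2 - u))) ≤ Real.exp (-τ * u ^ (1 / 2 : ℝ)) := by
    rw [← Real.sqrt_eq_rpow, Real.exp_le_exp, neg_mul, neg_mul, neg_le_neg_iff]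
    gcongr
    nlinarith
  have hr : (1 - u) ^ ((j : ℝ) - 2) ≤ 1 :=
    Real.rpow_le_one (by linarith) (by linarith) (by linarith)
  have hw : (u * (2 - u)) ^ (p / 2 - 1) ≤ u ^ (p / 2 - 1) * 2 ^ |p / 2 - 1| := by
    rw [Real.mul_rpow h0.le (by linarith)]
    gcongr
    exact rpow_le_two_rpow_abs (by linarith) (by linarith) _
  have hw0 : 0 ≤ (u * (2 - u)) ^ (p / 2 - 1) :=
    Real.rpow_nonneg (mul_nonneg h0.le (by linarith)) _
  have hr0 : 0 ≤ (1 - u) ^ ((j : ℝ) - 2) := Real.rpow_nonneg (by linarith) _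
  calc phiKernel j p τ u
      ≤ Real.exp (-τ * u ^ (1 / 2 : ℝ)) * 1 * (u ^ (p / 2 - 1) * 2 ^ |p / 2 - 1|) := by
        unfold phiKernel
        gcongr
    _ = _ := by ring

lemma integrableOn_rpow_Ioo {p : ℝ} (hp : 0 < p) (t : ℝ) :
    IntegrableOn (fun u : ℝ => u ^ (p / 2 - 1)) (Ioo 0 t) := by
  rcases le_total t 0 with ht | ht
  · simp [Ioo_eq_empty (not_lt.mpr ht)]
  · have h := intervalIntegral.intervalIntegrable_rpow' (a := 0) (b := t)
      (show -1 < p / 2 - 1 by linarith)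
    exact ((intervalIntegrable_iff_integrableOn_Ioc_of_le ht).1 h).mono_set Ioo_subset_Ioc_self

lemma norm_phiKernel_le {j : ℕ} (hj : 2 ≤ j) (p : ℝ) {τ u : ℝ} (hτ : 0 ≤ τ)
    (hu : u ∈ Ioo (0 : ℝ) 1) :
    ‖phiKernel j p τ u‖ ≤ 2 ^ |p / 2 - 1| * u ^ (p / 2 - 1) := by
  rw [Real.norm_of_nonneg (phiKernel_pos j p τ hu).le]
  refine (phiKernel_le hj p hτ hu).trans ?_
  have h0 : 0 ≤ u ^ (p / 2 - 1) := Real.rpow_nonneg hu.1.le _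
  have h1 : 0 ≤ u ^ (1 / 2 : ℝ) := Real.rpow_nonneg hu.1.le _
  gcongr
  refine mul_le_of_le_one_right h0 (Real.exp_le_one_iff.2 ?_)
  nlinarith

lemma integrableOn_phiKernel {j : ℕ} (hj : 2 ≤ j) {p τ : ℝ} (hp : 0 < p) (hτ : 0 ≤ τ) :
    IntegrableOn (phiKernel j p τ) (Ioo 0 1) :=
  ((integrableOn_rpow_Ioo hp 1).const_mul (2 ^ |p / 2 - 1|)).mono'
    (measurable_phiKernel j p τ).aestronglyMeasurable
    ((ae_restrict_mem measurableSet_Ioo).mono fun _ hu => norm_phiKernel_le hj p hτ hu)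

lemma continuousOn_PhiFun {j : ℕ} (hj : 2 ≤ j) {p : ℝ} (hp : 0 < p) :
    ContinuousOn (PhiFun j p) (Ici 0) := by
  rw [show PhiFun j p = fun τ => ∫ u in Ioo (0 : ℝ) 1, phiKernel j p τ u from
    funext (PhiFun_eq_integral_phiKernel j p)]
  refine continuousOn_of_dominated (bound := fun u => 2 ^ |p / 2 - 1| * u ^ (p / 2 - 1))
    (fun τ _ => (measurable_phiKernel j p τ).aestronglyMeasurable)
    (fun τ hτ => (ae_restrict_mem measurableSet_Ioo).mono
      fun u hu => norm_phiKernel_le hj p hτ hu)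
    ((integrableOn_rpow_Ioo hp 1).const_mul _) (.of_forall fun u => ?_)
  unfold phiKernel
  fun_prop

lemma PhiFun_pos {j : ℕ} (hj : 2 ≤ j) {p τ : ℝ} (hp : 0 < p) (hτ : 0 ≤ τ) :
    0 < PhiFun j p τ := by
  rw [PhiFun_eq_integral_phiKernel, ← integral_Ioc_eq_integral_Ioo,
    ← intervalIntegral.integral_of_le zero_le_one]
  refine intervalIntegral.intervalIntegral_pos_of_pos_on ?_
    (fun u hu => phiKernel_pos j p τ hu) zero_lt_one
  rw [intervalIntegrable_iff_integrableOn_Ioo_of_le zero_le_one]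
  exact integrableOn_phiKernel hj hp hτ

lemma PhiFun_le {j : ℕ} (hj : 2 ≤ j) {p τ : ℝ} (hp : 0 < p) (hτ : 0 < τ) :
    PhiFun j p τ ≤ 2 ^ |p / 2 - 1| * (2 * Real.Gamma p) * τ ^ (-p) := by
  have hval := integral_rpow_mul_exp_neg_mul_rpow (p := 1 / 2) (q := p / 2 - 1) (b := τ)
    (by norm_num) (by linarith) hτ
  have hInt : IntegrableOn
      (fun u : ℝ => u ^ (p / 2 - 1) * Real.exp (-τ * u ^ (1 / 2 : ℝ))) (Ioi 0) := by
    refine .of_integral_ne_zero ?_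
    rw [hval]
    have : 0 < (p / 2 - 1 + 1) / (1 / 2) := by linarith
    have := Real.Gamma_pos_of_pos this
    positivity
  rw [show (p / 2 - 1 + 1) / (1 / 2) = p by ring,
    show -(p / 2 - 1 + 1) / (1 / 2) = -p by ring] at hval
  calc PhiFun j p τ = ∫ u in Ioo (0 : ℝ) 1, phiKernel j p τ u :=
        PhiFun_eq_integral_phiKernel j p τ
    _ ≤ ∫ u in Ioo (0 : ℝ) 1,
          2 ^ |p / 2 - 1| * (u ^ (p / 2 - 1) * Real.exp (-τ * u ^ (1 / 2 : ℝ))) :=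
        setIntegral_mono_on (integrableOn_phiKernel hj hp hτ.le)
          ((hInt.mono_set Ioo_subset_Ioi_self).const_mul _) measurableSet_Ioo
          fun u hu => phiKernel_le hj p hτ.le hu
    _ ≤ ∫ u in Ioi (0 : ℝ),
          2 ^ |p / 2 - 1| * (u ^ (p / 2 - 1) * Real.exp (-τ * u ^ (1 / 2 : ℝ))) := by
        refine setIntegral_mono_set (hInt.const_mul _) ?_ Ioo_subset_Ioi_self.eventuallyLE
        filter_upwards [ae_restrict_mem measurableSet_Ioi] with u hu
        have : 0 < u := hu
        simp only [Pi.zero_apply]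
        positivity
    _ = _ := by
        rw [integral_const_mul, hval]
        ring

lemma le_phiKernel {j : ℕ} (hj : 2 ≤ j) (p : ℝ) {τ u : ℝ} (hτ : 2 ≤ τ)
    (hu : u ∈ Ioo (0 : ℝ) (τ ^ (-2 : ℝ))) :
    Real.exp (-2) * (1 / 2) ^ ((j : ℝ) - 2) * 2 ^ (-|p / 2 - 1|) * u ^ (p / 2 - 1) ≤
      phiKernel j p τ u := by
  obtain ⟨h0, h1⟩ := hu
  have hτ0 : 0 < τ := by linarith
  have hj' : (2 : ℝ) ≤ j := by exact_mod_cast hj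
  rw [Real.rpow_neg hτ0.le, Real.rpow_two, lt_inv_comm₀ h0 (by positivity)] at h1
  have hmul : τ ^ 2 * u < 1 := by
    rwa [lt_inv_comm₀ (by positivity) h0, ← one_div, lt_div_iff₀' (by positivity)] at h1
  have hu4 : u ≤ 1 / 4 := by nlinarith
  have hexp : τ * Real.sqrt (u * (2 - u)) ≤ 2 := by
    refine abs_le_of_sq_le_sq' ?_ (by norm_num) |>.2
    rw [mul_pow, Real.sq_sqrt (mul_nonneg h0.le (by linarith))]
    nlinarith [mul_nonneg (sq_nonneg τ) (sq_nonneg u)]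
  have hw0 : 0 ≤ u ^ (p / 2 - 1) := Real.rpow_nonneg h0.le _
  unfold phiKernel
  rw [Real.mul_rpow h0.le (by linarith), mul_assoc, mul_comm (u ^ (p / 2 - 1))]
  have hr0 : 0 ≤ (1 - u) ^ ((j : ℝ) - 2) := Real.rpow_nonneg (by linarith) _
  gcongr
  · linarith
  · linarith
  · exact two_rpow_neg_abs_le_rpow (by linarith) (by linarith) _

lemma le_PhiFun {j : ℕ} (hj : 2 ≤ j) {p τ : ℝ} (hp : 0 < p) (hτ : 2 ≤ τ) :
    Real.exp (-2) * (1 / 2) ^ ((j : ℝ) - 2) * 2 ^ (-|p / 2 - 1|) * (2 / p) * τ ^ (-p) ≤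
      PhiFun j p τ := by
  have hτ0 : 0 < τ := by linarith
  have ht0 : 0 ≤ τ ^ (-2 : ℝ) := by positivity
  have hsub : Ioo (0 : ℝ) (τ ^ (-2 : ℝ)) ⊆ Ioo 0 1 :=
    Ioo_subset_Ioo_right (Real.rpow_le_one_of_one_le_of_nonpos (by linarith) (by norm_num))
  have hInt := integrableOn_phiKernel hj hp hτ0.le
  have hval : ∫ u in Ioo (0 : ℝ) (τ ^ (-2 : ℝ)), u ^ (p / 2 - 1) = 2 / p * τ ^ (-p) := by
    rw [← integral_Ioc_eq_integral_Ioo, ← intervalIntegral.integral_of_le ht0,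
      integral_rpow (.inl (by linarith)), ← Real.rpow_mul hτ0.le, sub_add_cancel,
      Real.zero_rpow (by positivity), show -2 * (p / 2) = -p by ring]
    field_simp
    ring
  calc _ = ∫ u in Ioo (0 : ℝ) (τ ^ (-2 : ℝ)),
        Real.exp (-2) * (1 / 2) ^ ((j : ℝ) - 2) * 2 ^ (-|p / 2 - 1|) * u ^ (p / 2 - 1) := by
        rw [integral_const_mul, hval]
        ring
    _ ≤ ∫ u in Ioo (0 : ℝ) (τ ^ (-2 : ℝ)), phiKernel j p τ u :=
        setIntegral_mono_on ((integrableOn_rpow_Ioo hp _).const_mul _) (hInt.mono_set hsub)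
          measurableSet_Ioo fun u hu => le_phiKernel hj p hτ hu
    _ ≤ ∫ u in Ioo (0 : ℝ) 1, phiKernel j p τ u :=
        setIntegral_mono_set hInt
          ((ae_restrict_mem measurableSet_Ioo).mono fun u hu => (phiKernel_pos j p τ hu).le)
          hsub.eventuallyLE
    _ = PhiFun j p τ := (PhiFun_eq_integral_phiKernel j p τ).symm

/-- The function `Φ` is continuous and strictly positive on `[0,∞)`, is `O(τ^{−p})` for
`τ > 0`, and is bounded below by a multiple of `τ^{−p}` for `τ ≥ 2`
(estimates (3.26)–(3.28)). -/
theorem Phi_estimates (j : ℕ) (hj : 2 ≤ j) (p : ℝ) (hp : 0 < p) :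
    ContinuousOn (PhiFun j p) (Ici (0 : ℝ)) ∧
    (∀ τ : ℝ, 0 ≤ τ → 0 < PhiFun j p τ) ∧
    ∃ c : ℝ, 0 < c ∧
      (∀ τ : ℝ, 0 < τ → PhiFun j p τ ≤ c * τ ^ (-p)) ∧
      (∀ τ : ℝ, 2 ≤ τ → (1 / c) * τ ^ (-p) ≤ PhiFun j p τ) := by
  have hΓ := Real.Gamma_pos_of_pos hp
  set C : ℝ := 2 ^ |p / 2 - 1| * (2 * Real.Gamma p) with hC
  set k : ℝ := Real.exp (-2) * (1 / 2) ^ ((j : ℝ) - 2) * 2 ^ (-|p / 2 - 1|) * (2 / p) with hk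
  have hC0 : 0 < C := by positivity
  have hk0 : 0 < k := by positivity
  refine ⟨continuousOn_PhiFun hj hp, fun τ hτ => PhiFun_pos hj hp hτ, C + 1 / k,
    by positivity, fun τ hτ => (PhiFun_le hj hp hτ).trans ?_,
    fun τ hτ => le_trans ?_ (le_PhiFun hj hp hτ)⟩
  · gcongr
    exact le_add_of_nonneg_right (by positivity)
  · have hτ0 : 0 < τ := by linarith
    gcongr
    rw [← hk, one_div_le (by positivity) hk0]
    exact le_add_of_nonneg_left hC0.le
end

section
/- Let j ≥ 2 be an integer, let p > 0 be real, and let g : (0, ∞) → [0, ∞] be Lebesgue measurable. Then ∫₀^∞ ∫₀^∞ g(√(y₁² + ρ²)) e^{−y₁} y₁^{p−1} ρ^{j−2} dρ dy₁ = ∫₀^∞ g(τ) τ^{p+j−2} Φ(τ) dτ, where Φ(τ) := ∫₀¹ e^{−τ√(1−r²)} r^{j−2} (1−r²)^{p/2−1} dr, and both sides are allowed to equal +∞. -/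
open MeasureTheory Set
open scoped ENNReal

theorem hasDerivAt_div_sqrt_one_sub_sq {r : ℝ} (hr : r ∈ Ioo (0 : ℝ) 1) :
    HasDerivAt (fun r : ℝ => r / Real.sqrt (1 - r ^ 2)) ((Real.sqrt (1 - r ^ 2) ^ 3)⁻¹) r := by
  have h : 0 < 1 - r ^ 2 := by nlinarith [hr.1, hr.2]
  have hc : 0 < Real.sqrt (1 - r ^ 2) := Real.sqrt_pos.2 h
  have hs : HasDerivAt (fun r : ℝ => 1 - r ^ 2) (-(2 * r)) r := by
    simpa using (hasDerivAt_pow 2 r).const_sub 1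
  have hsq := Real.sq_sqrt h.le
  refine ((hasDerivAt_id' r).div (hs.sqrt h.ne') hc.ne').congr_deriv ?_
  field_simp
  linear_combination hsq

theorem injOn_div_sqrt_one_sub_sq :
    InjOn (fun r : ℝ => r / Real.sqrt (1 - r ^ 2)) (Ioo 0 1) := by
  intro a ha b hb hab
  have h1 : 0 < 1 - a ^ 2 := by nlinarith [ha.1, ha.2]
  have h2 : 0 < 1 - b ^ 2 := by nlinarith [hb.1, hb.2]
  have h := congrArg (· ^ 2) hab
  simp only [div_pow, Real.sq_sqrt h1.le, Real.sq_sqrt h2.le] at h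
  field_simp at h
  exact (pow_left_inj₀ ha.1.le hb.1.le two_ne_zero).1 (by linarith)

theorem image_div_sqrt_one_sub_sq :
    (fun r : ℝ => r / Real.sqrt (1 - r ^ 2)) '' Ioo 0 1 = Ioi 0 := by
  ext x
  constructor
  · rintro ⟨r, hr, rfl⟩
    have h : 0 < 1 - r ^ 2 := by nlinarith [hr.1, hr.2]
    exact div_pos hr.1 (Real.sqrt_pos.2 h)
  · intro hx
    have hx : 0 < x := hx
    have hs : 0 < Real.sqrt (1 + x ^ 2) := Real.sqrt_pos.2 (by positivity)
    have hsq : Real.sqrt (1 + x ^ 2) ^ 2 = 1 + x ^ 2 := Real.sq_sqrt (by positivity)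
    refine ⟨x / Real.sqrt (1 + x ^ 2), ⟨by positivity, ?_⟩, ?_⟩
    · rw [div_lt_one hs]
      exact Real.lt_sqrt_of_sq_lt (by linarith)
    · have : 1 - (x / Real.sqrt (1 + x ^ 2)) ^ 2 = (1 / Real.sqrt (1 + x ^ 2)) ^ 2 := by
        field_simp
        linarith
      simp only [this, Real.sqrt_sq (show 0 ≤ 1 / Real.sqrt (1 + x ^ 2) by positivity)]
      field_simp

theorem lintegral_Ioi_zero_comp_const_mul {c : ℝ} (hc : 0 < c) (F : ℝ → ℝ≥0∞) :
    ∫⁻ y in Ioi (0 : ℝ), F y = ∫⁻ τ in Ioi (0 : ℝ), ENNReal.ofReal c * F (c * τ) := by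
  have h := lintegral_image_eq_lintegral_abs_deriv_mul (s := Ioi (0 : ℝ)) (f := fun x => c * x)
    (f' := fun _ => c) measurableSet_Ioi
    (fun x _ => by simpa using ((hasDerivAt_id' x).const_mul c).hasDerivWithinAt)
    (mul_right_injective₀ hc.ne').injOn F
  simpa only [image_const_mul_Ioi_zero hc, abs_of_pos hc] using h

theorem lintegral_Ioi_zero_comp_div_sqrt (F : ℝ → ℝ≥0∞) :
    ∫⁻ x in Ioi (0 : ℝ), F x = ∫⁻ r in Ioo (0 : ℝ) 1,
      ENNReal.ofReal ((Real.sqrt (1 - r ^ 2) ^ 3)⁻¹) * F (r / Real.sqrt (1 - r ^ 2)) := by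
  have h := lintegral_image_eq_lintegral_abs_deriv_mul measurableSet_Ioo
    (fun r hr => (hasDerivAt_div_sqrt_one_sub_sq hr).hasDerivWithinAt)
    injOn_div_sqrt_one_sub_sq F
  rw [image_div_sqrt_one_sub_sq] at h
  rw [h]
  refine setLIntegral_congr_fun measurableSet_Ioo fun r _ => ?_
  rw [abs_of_nonneg (by positivity)]

theorem integrableOn_PhiFun_integrand {j : ℕ} (hj : 2 ≤ j) {p : ℝ} (hp : 0 < p) (τ : ℝ) :
    IntegrableOn (fun r : ℝ => Real.exp (-τ * Real.sqrt (1 - r ^ 2)) * r ^ ((j : ℝ) - 2) *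
      (1 - r ^ 2) ^ (p / 2 - 1)) (Ioo 0 1) := by
  have hj' : (0 : ℝ) ≤ (j : ℝ) - 2 := by
    have : (2 : ℝ) ≤ j := by exact_mod_cast hj
    linarith
  have h1 : IntervalIntegrable (fun r : ℝ => (1 - r) ^ (p / 2 - 1)) volume 0 1 := by
    have := (intervalIntegral.intervalIntegrable_rpow' (a := 0) (b := 1)
      (show -1 < p / 2 - 1 by linarith)).comp_sub_left 1
    simpa using this.symm
  have h2 : ContinuousOn (fun r : ℝ => Real.exp (-τ * Real.sqrt (1 - r ^ 2)) *
      r ^ ((j : ℝ) - 2) * (1 + r) ^ (p / 2 - 1)) (uIcc 0 1) := by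
    rw [uIcc_of_le zero_le_one]
    refine ContinuousOn.mul (Continuous.continuousOn ?_) ?_
    · exact (by fun_prop : Continuous fun r : ℝ => Real.exp (-τ * Real.sqrt (1 - r ^ 2))).mul
        (Real.continuous_rpow_const hj')
    · exact ContinuousOn.rpow_const (by fun_prop) fun r hr => Or.inl (by linarith [hr.1])
  have h3 := h1.mul_continuousOn h2
  rw [intervalIntegrable_iff_integrableOn_Ioo_of_le zero_le_one] at h3
  refine h3.congr_fun (fun r hr => ?_) measurableSet_Ioo
  have : (1 - r ^ 2) ^ (p / 2 - 1) = (1 - r) ^ (p / 2 - 1) * (1 + r) ^ (p / 2 - 1) := by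
    rw [← Real.mul_rpow (by linarith [hr.2]) (by linarith [hr.1])]
    congr 1
    ring
  rw [this]
  ring

theorem ofReal_rpow_mul_PhiFun {j : ℕ} (hj : 2 ≤ j) {p : ℝ} (hp : 0 < p) {τ : ℝ} (hτ : 0 < τ) :
    ENNReal.ofReal (τ ^ (p + (j : ℝ) - 2) * PhiFun j p τ) =
      ∫⁻ r in Ioo (0 : ℝ) 1, ENNReal.ofReal (τ ^ (p + (j : ℝ) - 2) *
        (Real.exp (-τ * Real.sqrt (1 - r ^ 2)) * r ^ ((j : ℝ) - 2) *
          (1 - r ^ 2) ^ (p / 2 - 1))) := by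
  rw [PhiFun, ← integral_const_mul, ofReal_integral_eq_lintegral_ofReal
    ((integrableOn_PhiFun_integrand hj hp τ).const_mul _)]
  filter_upwards [ae_restrict_mem measurableSet_Ioo] with r hr
  have h : 0 < 1 - r ^ 2 := by nlinarith [hr.1, hr.2]
  have := hr.1
  simp only [Pi.zero_apply]
  positivity

theorem polar_jacobian_identity {a p τ r : ℝ} (hτ : 0 < τ) (hr : r ∈ Ioo (0 : ℝ) 1) :
    Real.sqrt (1 - r ^ 2) * ((Real.sqrt (1 - r ^ 2) ^ 3)⁻¹ * ((Real.sqrt (1 - r ^ 2) * τ) *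
      (Real.exp (-(Real.sqrt (1 - r ^ 2) * τ)) * (Real.sqrt (1 - r ^ 2) * τ) ^ (p - 1) *
        (Real.sqrt (1 - r ^ 2) * τ * (r / Real.sqrt (1 - r ^ 2))) ^ (a - 2)))) =
    τ ^ (p + a - 2) * (Real.exp (-τ * Real.sqrt (1 - r ^ 2)) * r ^ (a - 2) *
          (1 - r ^ 2) ^ (p / 2 - 1)) := by
  have h : 0 < 1 - r ^ 2 := by nlinarith [hr.1, hr.2]
  have hc : 0 < Real.sqrt (1 - r ^ 2) := Real.sqrt_pos.2 h
  have h1 : (1 - r ^ 2) ^ (p / 2 - 1) = Real.sqrt (1 - r ^ 2) ^ (p - 2) := by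
    rw [Real.sqrt_eq_rpow, ← Real.rpow_mul h.le]
    congr 1
    ring
  rw [h1]
  generalize Real.sqrt (1 - r ^ 2) = c at hc
  have h2 : c * τ * (r / c) = τ * r := by field_simp
  have h3 : τ ^ (p + a - 2) = τ ^ (p - 1) * τ ^ (a - 2) * τ := by
    rw [← Real.rpow_add hτ, ← Real.rpow_add_one hτ.ne']
    congr 1
    ring
  have h4 : c ^ (p - 1) = c ^ (p - 2) * c := by
    rw [← Real.rpow_add_one hc.ne']
    congr 1
    ring
  rw [h2, h3, Real.mul_rpow hc.le hτ.le, Real.mul_rpow hτ.le hr.1.le, h4,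
    show -(c * τ) = -τ * c by ring]
  field_simp

/-- The polar-type change of variables reducing the half-space integral to a
one-dimensional weighted integral:
`∫₀^∞ ∫₀^∞ g(√(y₁²+ρ²)) e^{−y₁} y₁^{p−1} ρ^{j−2} dρ dy₁ = ∫₀^∞ g(τ) τ^{p+j−2} Φ(τ) dτ`. -/
theorem polar_change_of_variables (j : ℕ) (hj : 2 ≤ j) (p : ℝ) (hp : 0 < p)
    (g : ℝ → ℝ≥0∞) (hg : Measurable g) :
    (∫⁻ y₁ in Ioi (0 : ℝ), ∫⁻ ρ in Ioi (0 : ℝ),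
        g (Real.sqrt (y₁ ^ 2 + ρ ^ 2)) *
          ENNReal.ofReal (Real.exp (-y₁) * y₁ ^ (p - 1) * ρ ^ ((j : ℝ) - 2))) =
      ∫⁻ τ in Ioi (0 : ℝ), g τ * ENNReal.ofReal (τ ^ (p + (j : ℝ) - 2) * PhiFun j p τ) := by
  set W : ℝ → ℝ → ℝ≥0∞ := fun y ρ => g (Real.sqrt (y ^ 2 + ρ ^ 2)) *
    ENNReal.ofReal (Real.exp (-y) * y ^ (p - 1) * ρ ^ ((j : ℝ) - 2)) with hW
  calc ∫⁻ y in Ioi (0 : ℝ), ∫⁻ ρ in Ioi (0 : ℝ), W y ρ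
      = ∫⁻ y in Ioi (0 : ℝ), ∫⁻ r in Ioo (0 : ℝ) 1,
          ENNReal.ofReal ((Real.sqrt (1 - r ^ 2) ^ 3)⁻¹) *
            (ENNReal.ofReal y * W y (y * (r / Real.sqrt (1 - r ^ 2)))) := by
        refine setLIntegral_congr_fun measurableSet_Ioi fun y hy => ?_
        rw [lintegral_Ioi_zero_comp_const_mul hy, lintegral_Ioi_zero_comp_div_sqrt]
    _ = ∫⁻ r in Ioo (0 : ℝ) 1, ∫⁻ y in Ioi (0 : ℝ),
          ENNReal.ofReal ((Real.sqrt (1 - r ^ 2) ^ 3)⁻¹) *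
            (ENNReal.ofReal y * W y (y * (r / Real.sqrt (1 - r ^ 2)))) := by
        refine lintegral_lintegral_swap (Measurable.aemeasurable ?_)
        simp only [hW, Function.uncurry_def]
        fun_prop
    _ = ∫⁻ r in Ioo (0 : ℝ) 1, ∫⁻ τ in Ioi (0 : ℝ),
          g τ * ENNReal.ofReal (τ ^ (p + (j : ℝ) - 2) *
            (Real.exp (-τ * Real.sqrt (1 - r ^ 2)) * r ^ ((j : ℝ) - 2) *
              (1 - r ^ 2) ^ (p / 2 - 1))) := by
        refine setLIntegral_congr_fun measurableSet_Ioo fun r hr => ?_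
        have h : 0 < 1 - r ^ 2 := by nlinarith [hr.1, hr.2]
        have hc : 0 < Real.sqrt (1 - r ^ 2) := Real.sqrt_pos.2 h
        have hsq := Real.sq_sqrt h.le
        rw [lintegral_Ioi_zero_comp_const_mul hc]
        refine setLIntegral_congr_fun measurableSet_Ioi fun τ hτ => ?_
        have hτ : 0 < τ := hτ
        have hnorm : Real.sqrt ((Real.sqrt (1 - r ^ 2) * τ) ^ 2 +
            (Real.sqrt (1 - r ^ 2) * τ * (r / Real.sqrt (1 - r ^ 2))) ^ 2) = τ := by
          rw [← Real.sqrt_sq hτ.le]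
          congr 1
          rw [Real.sqrt_sq hτ.le]
          field_simp
          linear_combination hsq
        simp only [hW]
        rw [hnorm, ← polar_jacobian_identity hτ hr, ENNReal.ofReal_mul (q := _⁻¹ * _) hc.le,
          ENNReal.ofReal_mul (by positivity : 0 ≤ (Real.sqrt (1 - r ^ 2) ^ 3)⁻¹),
          ENNReal.ofReal_mul (by positivity : 0 ≤ Real.sqrt (1 - r ^ 2) * τ)]
        ring
    _ = ∫⁻ τ in Ioi (0 : ℝ), ∫⁻ r in Ioo (0 : ℝ) 1,
          g τ * ENNReal.ofReal (τ ^ (p + (j : ℝ) - 2) *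
            (Real.exp (-τ * Real.sqrt (1 - r ^ 2)) * r ^ ((j : ℝ) - 2) *
              (1 - r ^ 2) ^ (p / 2 - 1))) := by
        refine lintegral_lintegral_swap (Measurable.aemeasurable ?_)
        simp only [Function.uncurry_def]
        fun_prop
    _ = _ := by
        refine setLIntegral_congr_fun measurableSet_Ioi fun τ hτ => ?_
        rw [ofReal_rpow_mul_PhiFun hj hp hτ, lintegral_const_mul _ (by fun_prop)]
end
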